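/- Let A be a real m×n matrix with nonzero rows a_1,…,a_m, let x ∈ ℝⁿ with A x = b, and suppose x_k ≠ x. Then the expectation over one randomized Kaczmarz step (choosing row i with probability ‖a_i‖²/‖A‖_F²) satisfies 𝔼[ ‖x_{k+1} − x‖² | x_k ] ≤ ( 1 − (1/‖A‖_F²) · ‖ A (x_k − x)/‖x_k − x‖ ‖² ) · ‖x_k − x‖². -/

import Mathlib

open scoped BigOperators RealInnerProductSpace Matrix

noncomputable section

/-- The `i`-th row of the matrix `A`, viewed as a vector in Euclidean space `ℝⁿ`. -/
def kacRow {m n : ℕ} (A : Matrix (Fin m) (Fin n) ℝ) (i : Fin m) :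
    EuclideanSpace ℝ (Fin n) :=
  (EuclideanSpace.equiv (Fin n) ℝ).symm (A i)

/-- The squared Frobenius norm of `A`: `‖A‖_F² = ∑ i ‖a i‖²` where `a i` are the rows. -/
def frob2 {m n : ℕ} (A : Matrix (Fin m) (Fin n) ℝ) : ℝ :=
  ∑ i, ‖kacRow A i‖ ^ 2

/-- The matrix `A` acting on `y ∈ ℝⁿ`, viewed as a vector in Euclidean space `ℝᵐ`. -/
def mulE {m n : ℕ} (A : Matrix (Fin m) (Fin n) ℝ) (y : EuclideanSpace ℝ (Fin n)) :
    EuclideanSpace ℝ (Fin m) :=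
  (EuclideanSpace.equiv (Fin m) ℝ).symm (A *ᵥ (EuclideanSpace.equiv (Fin n) ℝ y))

theorem mulE_apply {m n : ℕ} (A : Matrix (Fin m) (Fin n) ℝ)
    (y : EuclideanSpace ℝ (Fin n)) (i : Fin m) : mulE A y i = ⟪kacRow A i, y⟫ := by
  simp [mulE, kacRow, Matrix.mulVec, dotProduct, PiLp.inner_apply, mul_comm]

theorem norm_mulE_sq {m n : ℕ} (A : Matrix (Fin m) (Fin n) ℝ)
    (y : EuclideanSpace ℝ (Fin n)) : ‖mulE A y‖ ^ 2 = ∑ i, ⟪kacRow A i, y⟫ ^ 2 := by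
  simp [EuclideanSpace.norm_sq_eq, mulE_apply]

theorem norm_mulE_inv_norm_smul_sq {m n : ℕ} (A : Matrix (Fin m) (Fin n) ℝ)
    {y : EuclideanSpace ℝ (Fin n)} (hy : y ≠ 0) :
    ‖mulE A (‖y‖⁻¹ • y)‖ ^ 2 * ‖y‖ ^ 2 = ∑ i, ⟪kacRow A i, y⟫ ^ 2 := by
  have hy' : ‖y‖ ≠ 0 := norm_ne_zero_iff.mpr hy
  rw [norm_mulE_sq, Finset.sum_mul]
  refine Finset.sum_congr rfl fun i _ => ?_
  rw [real_inner_smul_right]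
  field_simp

/-- Pythagoras for the projection of `e` onto the hyperplane orthogonal to `a`. -/
theorem norm_sq_mul_norm_sub_proj_sq {E : Type*} [NormedAddCommGroup E] [InnerProductSpace ℝ E]
    {a : E} (ha : a ≠ 0) (e : E) :
    ‖a‖ ^ 2 * ‖e - (⟪a, e⟫ / ‖a‖ ^ 2) • a‖ ^ 2 = ‖a‖ ^ 2 * ‖e‖ ^ 2 - ⟪a, e⟫ ^ 2 := by
  have ha' : ‖a‖ ≠ 0 := norm_ne_zero_iff.mpr ha
  rw [norm_sub_sq_real, real_inner_smul_right, norm_smul, mul_pow, Real.norm_eq_abs, sq_abs,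
    real_inner_comm a e]
  field_simp
  ring

/-- If `A x = b`, `x_k ≠ x`, and `x_{k+1}` is obtained from `x_k` by one randomized
Kaczmarz step (row `i` chosen with probability `‖a i‖²/‖A‖_F²`), then
`𝔼[‖x_{k+1} - x‖² | x_k] ≤ (1 - (1/‖A‖_F²) ‖A (x_k - x)/‖x_k - x‖‖²) ‖x_k - x‖²`. -/
theorem kaczmarz_expected_squared_error_bound {m n : ℕ}
    (A : Matrix (Fin m) (Fin n) ℝ) (ha : ∀ i, kacRow A i ≠ 0)
    (x : EuclideanSpace ℝ (Fin n)) (b : Fin m → ℝ)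
    (hb : ∀ i, b i = ⟪kacRow A i, x⟫)
    (xk : EuclideanSpace ℝ (Fin n)) (hxk : xk ≠ x) :
    ∑ i, (‖kacRow A i‖ ^ 2 / frob2 A) *
        ‖(xk + ((b i - ⟪kacRow A i, xk⟫) / ‖kacRow A i‖ ^ 2) • kacRow A i) - x‖ ^ 2
      ≤ (1 - (1 / frob2 A) * ‖mulE A ((‖xk - x‖)⁻¹ • (xk - x))‖ ^ 2) * ‖xk - x‖ ^ 2 := by
  have hterm : ∀ i, (‖kacRow A i‖ ^ 2 / frob2 A) *
      ‖(xk + ((b i - ⟪kacRow A i, xk⟫) / ‖kacRow A i‖ ^ 2) • kacRow A i) - x‖ ^ 2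
      = (‖kacRow A i‖ ^ 2 * ‖xk - x‖ ^ 2 - ⟪kacRow A i, xk - x⟫ ^ 2) / frob2 A := by
    intro i
    have hstep : (xk + ((b i - ⟪kacRow A i, xk⟫) / ‖kacRow A i‖ ^ 2) • kacRow A i) - x
        = (xk - x) - (⟪kacRow A i, xk - x⟫ / ‖kacRow A i‖ ^ 2) • kacRow A i := by
      rw [hb, inner_sub_right]
      module
    rw [hstep, ← norm_sq_mul_norm_sub_proj_sq (ha i), div_mul_eq_mul_div]
  have hsum : ∑ i, ‖kacRow A i‖ ^ 2 = frob2 A := rfl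
  rw [Finset.sum_congr rfl fun i _ => hterm i, ← Finset.sum_div, Finset.sum_sub_distrib,
    ← Finset.sum_mul, hsum, ← norm_mulE_inv_norm_smul_sq A (sub_ne_zero.mpr hxk), sub_div,
    mul_div_right_comm, mul_div_right_comm, sub_mul, one_div_mul_eq_div]
  exact sub_le_sub_right
    (mul_le_mul_of_nonneg_right (div_self_le_one (frob2 A)) (sq_nonneg _)) _
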